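/- arXiv:2605.17731 — 3 statements merged into one kernel-verified Lean document; each statement's English description precedes it below -/
import Mathlib

section
/- Let H be a real Hilbert space, δ > 0, and T : H → H be δ-strongly quasi-nonexpansive. Let z^0 ∈ H and define z^{k+1} = (1 − λ_k) z^k + λ_k T(z^k) for all k ∈ ℕ, where {λ_k} ⊆ [0, 1+δ] satisfies liminf_{k→∞} λ_k (1 − λ_k + δ) > 0. Then z^k − T(z^k) → 0 strongly in H as k → ∞. -/
open RealInnerProductSpace Filter

/-- One relaxed step of a strongly quasi-nonexpansive map decreases the squared distance to a
fixed point by a multiple of the squared residual. -/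
theorem norm_sq_relaxed_step_le {H : Type*} [NormedAddCommGroup H] [InnerProductSpace ℝ H]
    {δ t : ℝ} (ht : 0 ≤ t) {x y w : H}
    (h : ‖w - y‖ ^ 2 + δ * ‖x - w‖ ^ 2 ≤ ‖x - y‖ ^ 2) :
    ‖(1 - t) • x + t • w - y‖ ^ 2 + t * (1 - t + δ) * ‖x - w‖ ^ 2 ≤ ‖x - y‖ ^ 2 := by
  have hw : w - y = (x - y) - (x - w) := by abel
  have hstep : (1 - t) • x + t • w - y = (x - y) - t • (x - w) := by module
  rw [hw, norm_sub_sq_real] at h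
  rw [hstep, norm_sub_sq_real, inner_smul_right, norm_smul, mul_pow, Real.norm_eq_abs, sq_abs]
  nlinarith [mul_le_mul_of_nonneg_left h ht]

/-- Lemma 2.3(ii): for Krasnosel'skiĭ–Mann iterations of a δ-strongly quasi-nonexpansive
map, the residuals `z^k - T(z^k)` converge strongly to zero. -/
theorem KM_residual_tendsto_zero
    {H : Type*} [NormedAddCommGroup H] [InnerProductSpace ℝ H] [CompleteSpace H]
    (δ : ℝ) (hδ : 0 < δ) (T : H → H)
    (hfix : ∃ y, T y = y)
    (hsqne : ∀ x y : H, T y = y → ‖T x - y‖ ^ 2 + δ * ‖x - T x‖ ^ 2 ≤ ‖x - y‖ ^ 2)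
    (lam : ℕ → ℝ) (hlam : ∀ k, lam k ∈ Set.Icc (0 : ℝ) (1 + δ))
    (hliminf : 0 < Filter.liminf (fun k => lam k * (1 - lam k + δ)) Filter.atTop)
    (z : ℕ → H)
    (hrec : ∀ k : ℕ, z (k + 1) = (1 - lam k) • z k + lam k • T (z k)) :
    Filter.Tendsto (fun k => z k - T (z k)) Filter.atTop (nhds 0) := by
  obtain ⟨y, hy⟩ := hfix
  have hstep (k : ℕ) : ‖z (k + 1) - y‖ ^ 2 + lam k * (1 - lam k + δ) * ‖z k - T (z k)‖ ^ 2
      ≤ ‖z k - y‖ ^ 2 := by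
    rw [hrec k]
    exact norm_sq_relaxed_step_le (hlam k).1 (hsqne (z k) y hy)
  have hnonneg (k : ℕ) : 0 ≤ lam k * (1 - lam k + δ) :=
    mul_nonneg (hlam k).1 (by linarith [(hlam k).2])
  have hanti : Antitone fun k => ‖z k - y‖ ^ 2 :=
    antitone_nat_of_succ_le fun k => by
      linarith [hstep k, mul_nonneg (hnonneg k) (sq_nonneg ‖z k - T (z k)‖)]
  have hlim := tendsto_atTop_ciInf hanti ⟨0, by rintro _ ⟨k, rfl⟩; positivity⟩
  obtain ⟨c, hc, hc_lt⟩ := exists_between hliminf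
  have hev : ∀ᶠ k in atTop, c < lam k * (1 - lam k + δ) :=
    eventually_lt_of_lt_liminf hc_lt (isBoundedUnder_of ⟨0, hnonneg⟩)
  have hdiff : Tendsto (fun k => (‖z k - y‖ ^ 2 - ‖z (k + 1) - y‖ ^ 2) / c) atTop (nhds 0) := by
    simpa using (hlim.sub (hlim.comp (tendsto_add_atTop_nat 1))).div_const c
  have hsq : Tendsto (fun k => ‖z k - T (z k)‖ ^ 2) atTop (nhds 0) := by
    refine squeeze_zero' (Eventually.of_forall fun k => sq_nonneg _) ?_ hdiff
    filter_upwards [hev] with k hk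
    rw [le_div_iff₀ hc]
    linarith [hstep k, mul_le_mul_of_nonneg_right hk.le (sq_nonneg ‖z k - T (z k)‖)]
  rw [tendsto_zero_iff_norm_tendsto_zero]
  simpa [Real.sqrt_sq] using hsq.sqrt
end

section
/- Let H be a real Hilbert space, δ > 0, and T : H → H be δ-strongly quasi-nonexpansive. Let z^0 ∈ H and define z^{k+1} = (1 − λ_k) z^k + λ_k T(z^k) for all k ∈ ℕ, where {λ_k} ⊆ [0, 1+δ] satisfies liminf_{k→∞} λ_k (1 − λ_k + δ) > 0. Then the averaged residuals decay at rate O(1/√k): there exists a constant c > 0 such that for all k ≥ 1, ‖(1/(k+1)) ∑_{s=0}^{k} (z^s − T(z^s))‖ ≤ c/√k. -/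
open RealInnerProductSpace Filter Finset

/-- One relaxed step of a strongly quasi-nonexpansive map decreases the squared distance to a
fixed point by at least a multiple of the squared residual. -/
lemma norm_sq_relaxed_step_sub_le {H : Type*} [NormedAddCommGroup H] [InnerProductSpace ℝ H]
    {δ l : ℝ} (hl : 0 ≤ l) {x w y : H}
    (h : ‖w - y‖ ^ 2 + δ * ‖x - w‖ ^ 2 ≤ ‖x - y‖ ^ 2) :
    ‖(1 - l) • x + l • w - y‖ ^ 2 + l * (1 - l + δ) * ‖x - w‖ ^ 2 ≤ ‖x - y‖ ^ 2 := by
  have hw : w - y = (x - y) - (x - w) := by abel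
  have hstep : (1 - l) • x + l • w - y = (x - y) - l • (x - w) := by module
  rw [hw, norm_sub_sq_real] at h
  rw [hstep, norm_sub_sq_real, inner_smul_right, norm_smul, mul_pow, Real.norm_eq_abs, sq_abs]
  nlinarith [mul_le_mul_of_nonneg_left h hl]

/-- If the partial sums of `‖r s‖ ^ 2` are bounded, the averages of `r` are `O(1/√k)`. -/
lemma norm_average_le_of_sum_sq_le {E : Type*} [SeminormedAddCommGroup E] [NormedSpace ℝ E]
    {r : ℕ → E} {M : ℝ} (hM : ∀ n, ∑ s ∈ Finset.range n, ‖r s‖ ^ 2 ≤ M) {k : ℕ} (hk : 1 ≤ k) :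
    ‖(1 / ((k : ℝ) + 1)) • ∑ s ∈ Finset.range (k + 1), r s‖ ≤ √M / √k := by
  have hk0 : (0 : ℝ) < k := by exact_mod_cast hk
  have hM0 : 0 ≤ M := by simpa using hM 0
  rw [← Real.sqrt_div hM0]
  apply Real.le_sqrt_of_sq_le
  have hcs := sq_sum_le_card_mul_sum_sq (s := Finset.range (k + 1)) (f := fun s => ‖r s‖)
  rw [Finset.card_range, Nat.cast_succ] at hcs
  have hsum : ‖∑ s ∈ Finset.range (k + 1), r s‖ ^ 2 ≤ ((k : ℝ) + 1) * M :=
    calc ‖∑ s ∈ Finset.range (k + 1), r s‖ ^ 2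
        ≤ (∑ s ∈ Finset.range (k + 1), ‖r s‖) ^ 2 := by gcongr; exact norm_sum_le _ _
      _ ≤ ((k : ℝ) + 1) * ∑ s ∈ Finset.range (k + 1), ‖r s‖ ^ 2 := hcs
      _ ≤ ((k : ℝ) + 1) * M := by gcongr; exact hM _
  rw [norm_smul, mul_pow, Real.norm_of_nonneg (by positivity)]
  calc (1 / ((k : ℝ) + 1)) ^ 2 * ‖∑ s ∈ Finset.range (k + 1), r s‖ ^ 2
      ≤ (1 / ((k : ℝ) + 1)) ^ 2 * (((k : ℝ) + 1) * M) := by gcongr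
    _ = M / ((k : ℝ) + 1) := by field_simp
    _ ≤ M / k := by gcongr; linarith

/-- Lemma 2.3(iii): for Krasnosel'skiĭ–Mann iterations of a δ-strongly quasi-nonexpansive
map, the averaged residuals decay at rate O(1/√k). -/
theorem KM_averaged_residual_rate
    {H : Type*} [NormedAddCommGroup H] [InnerProductSpace ℝ H] [CompleteSpace H]
    (δ : ℝ) (hδ : 0 < δ) (T : H → H)
    (hfix : ∃ y, T y = y)
    (hsqne : ∀ x y : H, T y = y → ‖T x - y‖ ^ 2 + δ * ‖x - T x‖ ^ 2 ≤ ‖x - y‖ ^ 2)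
    (lam : ℕ → ℝ) (hlam : ∀ k, lam k ∈ Set.Icc (0 : ℝ) (1 + δ))
    (hliminf : 0 < Filter.liminf (fun k => lam k * (1 - lam k + δ)) Filter.atTop)
    (z : ℕ → H)
    (hrec : ∀ k : ℕ, z (k + 1) = (1 - lam k) • z k + lam k • T (z k)) :
    ∃ c : ℝ, 0 < c ∧ ∀ k : ℕ, 1 ≤ k →
      ‖(1 / ((k : ℝ) + 1)) • ∑ s ∈ Finset.range (k + 1), (z s - T (z s))‖
        ≤ c / Real.sqrt k := by
  obtain ⟨y, hy⟩ := hfix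
  obtain ⟨ε, hε, hεlim⟩ := exists_between hliminf
  have hbdd : IsBoundedUnder (· ≥ ·) atTop fun k => lam k * (1 - lam k + δ) :=
    isBoundedUnder_of ⟨0, fun k => mul_nonneg (hlam k).1 (by linarith [(hlam k).2])⟩
  obtain ⟨N, hN⟩ := eventually_atTop.1 (eventually_lt_of_lt_liminf hεlim hbdd)
  have hdecr : ∀ k, N ≤ k → ‖z (k + 1) - y‖ ^ 2 + ε * ‖z k - T (z k)‖ ^ 2 ≤ ‖z k - y‖ ^ 2 := by
    intro k hk
    rw [hrec]
    refine le_trans ?_ (norm_sq_relaxed_step_sub_le (hlam k).1 (hsqne (z k) y hy))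
    gcongr
    exact (hN k hk).le
  set S : ℕ → ℝ := fun n => ∑ s ∈ Finset.range n, ‖z s - T (z s)‖ ^ 2 with hS
  have htail : ∀ n, N ≤ n → ε * S n + ‖z n - y‖ ^ 2 ≤ ε * S N + ‖z N - y‖ ^ 2 := by
    intro n hn
    induction n, hn using Nat.le_induction with
    | base => exact le_rfl
    | succ n hn ih =>
      simp only [hS, Finset.sum_range_succ] at ih ⊢
      linarith [hdecr n hn]
  have hbound : ∀ n, S n ≤ (ε * S N + ‖z N - y‖ ^ 2) / ε := by
    intro n
    have hmono : S n ≤ S (max n N) :=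
      Finset.sum_le_sum_of_subset_of_nonneg (Finset.range_mono (le_max_left n N))
        fun _ _ _ => by positivity
    refine hmono.trans ((le_div_iff₀ hε).2 ?_)
    nlinarith [htail (max n N) (le_max_right n N), sq_nonneg ‖z (max n N) - y‖]
  refine ⟨√((ε * S N + ‖z N - y‖ ^ 2) / ε) + 1, by positivity, fun k hk => ?_⟩
  refine (norm_average_le_of_sum_sq_le hbound hk).trans ?_
  gcongr
  linarith
end

section
/- Let H be a real Hilbert space, n, m ≥ 1, and for j = 1,…,m let B_j : H → H be σ_j-cocoercive with σ_j > 0. Let H ∈ ℝ^{n×m} and G ∈ ℝ^{m×n} be matrices, and define B : H^m → H^m componentwise by B(u)_j = B_j(u_j). Then for all x, x̄ ∈ H^n: −⟨x − x̄, (H⊗Id)B((G⊗Id)x) − (H⊗Id)B((G⊗Id)x̄)⟩ ≤ (1/4) ∑_{j=1}^m (1/σ_j) ‖(((Hᵀ − G)⊗Id)(x − x̄))_j‖². -/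
open RealInnerProductSpace Finset

/-- Young's inequality for the inner product, with weight `σ`. -/
theorem neg_inner_sub_mul_sq_norm_le {E : Type*} [NormedAddCommGroup E] [InnerProductSpace ℝ E]
    {σ : ℝ} (hσ : 0 < σ) (v d : E) :
    -⟪v, d⟫ - σ * ‖d‖ ^ 2 ≤ 1 / 4 * (1 / σ * ‖v‖ ^ 2) := by
  have key : 0 ≤ ‖v + (2 * σ) • d‖ ^ 2 := sq_nonneg _
  rw [norm_add_sq_real, inner_smul_right, norm_smul, mul_pow, Real.norm_eq_abs, sq_abs] at key
  have h : 1 / 4 * (1 / σ * ‖v‖ ^ 2) = ‖v‖ ^ 2 / (4 * σ) := by field_simp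
  rw [h, le_div_iff₀ (by positivity)]
  linarith

/-- The inner product against a lifted matrix moves the transpose to the other side. -/
theorem sum_inner_sum_smul {ι κ E : Type*} [Fintype ι] [Fintype κ] [NormedAddCommGroup E]
    [InnerProductSpace ℝ E] (M : Matrix ι κ ℝ) (x : ι → E) (y : κ → E) :
    ∑ i, ⟪x i, ∑ j, M i j • y j⟫ = ∑ j, ⟪∑ i, M i j • x i, y j⟫ := by
  simp only [inner_sum, sum_inner, inner_smul_right, real_inner_smul_left]
  exact Finset.sum_comm

/-- The cocoercive cross-term estimate (inequality (103)) in the proof of Lemma 4.2: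
for σ_j-cocoercive operators B_j and matrices H ∈ ℝ^{n×m}, G ∈ ℝ^{m×n},
`-⟨x - x', (H⊗Id)B((G⊗Id)x) - (H⊗Id)B((G⊗Id)x')⟩
  ≤ (1/4) ∑_j (1/σ_j) ‖(((Hᵀ - G)⊗Id)(x - x'))_j‖²`. -/
theorem cocoercive_cross_term_estimate
    {H : Type*} [NormedAddCommGroup H] [InnerProductSpace ℝ H] [CompleteSpace H]
    (n m : ℕ) (hn : 1 ≤ n) (hm : 1 ≤ m)
    (B : Fin m → H → H) (σ : Fin m → ℝ) (hσpos : ∀ j, 0 < σ j)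
    (hcoco : ∀ j, ∀ u w : H, ⟪B j u - B j w, u - w⟫ ≥ σ j * ‖B j u - B j w‖ ^ 2)
    (Hm : Matrix (Fin n) (Fin m) ℝ) (G : Matrix (Fin m) (Fin n) ℝ)
    (x x' : Fin n → H) :
    -(∑ i, ⟪x i - x' i,
        (∑ j, Hm i j • B j (∑ h, G j h • x h)) -
        (∑ j, Hm i j • B j (∑ h, G j h • x' h))⟫)
      ≤ (1 / 4) * ∑ j, (1 / σ j) * ‖∑ i, (Hm i j - G j i) • (x i - x' i)‖ ^ 2 := by
  simp only [← Finset.sum_sub_distrib, ← smul_sub]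
  rw [sum_inner_sum_smul Hm (fun i => x i - x' i), ← Finset.sum_neg_distrib, Finset.mul_sum]
  refine Finset.sum_le_sum fun j _ => ?_
  have hG : ∑ i, Hm i j • (x i - x' i) = ∑ i, (Hm i j - G j i) • (x i - x' i)
      + (∑ i, G j i • x i - ∑ i, G j i • x' i) := by
    rw [← Finset.sum_sub_distrib, ← Finset.sum_add_distrib]
    refine Finset.sum_congr rfl fun i _ => ?_
    rw [← smul_sub, ← add_smul, sub_add_cancel]
  have hc := hcoco j (∑ i, G j i • x i) (∑ i, G j i • x' i)
  rw [real_inner_comm] at hc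
  rw [hG, inner_add_left]
  have hy := neg_inner_sub_mul_sq_norm_le (hσpos j) (∑ i, (Hm i j - G j i) • (x i - x' i))
    (B j (∑ i, G j i • x i) - B j (∑ i, G j i • x' i))
  linarith
end
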